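/- The number of words over the alphabet {R, U, D} consisting of exactly k letters R, k letters U, and n − k letters D, whose first letter is not D, and in which some letter D has no letter R occurring before it, equals binomial(n + k − 1, k − 1) · binomial(n − 1, k). (Here binomial(a, b) = 0 when b > a; in particular when k = n this count is 0.) -/

import Mathlib

inductive Letter : Type
  | R | U | D
deriving DecidableEq

namespace Letter

/-- Splitting a set of words according to the first letter. -/
theorem encard_eq_add_cons (S : Set (List Letter)) :
    S.encard = ({w | w = [] ∧ w ∈ S} : Set (List Letter)).encard + {w | R :: w ∈ S}.encard +
      {w | U :: w ∈ S}.encard + {w | D :: w ∈ S}.encard := by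
  have hS : S = (({w | w = [] ∧ w ∈ S} ∪ List.cons R '' {w | R :: w ∈ S}) ∪
      List.cons U '' {w | U :: w ∈ S}) ∪ List.cons D '' {w | D :: w ∈ S} := by
    ext w
    rcases w with _ | ⟨_ | _ | _, w⟩ <;> simp
  conv_lhs => rw [hS]
  rw [Set.encard_union_eq, Set.encard_union_eq, Set.encard_union_eq,
    List.cons_injective.encard_image, List.cons_injective.encard_image,
    List.cons_injective.encard_image]
  all_goals
    rw [Set.disjoint_left]
    intro w
    rcases w with _ | ⟨_ | _ | _, w⟩ <;> simp

/-- The words with `r` letters R, `u` letters U and `d` letters D. -/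
def words (r u d : ℕ) : Set (List Letter) :=
  {w | w.count R = r ∧ w.count U = u ∧ w.count D = d}

/-- The words with a letter D that has no letter R before it. -/
def earlyD : Set (List Letter) := {w | ∃ u v : List Letter, w = u ++ D :: v ∧ R ∉ u}

theorem nil_notMem_earlyD : [] ∉ earlyD := by simp [earlyD]

theorem cons_R_notMem_earlyD (w : List Letter) : R :: w ∉ earlyD := by
  rintro ⟨_ | ⟨a, u⟩, v, h, hu⟩ <;> simp_all

theorem cons_D_mem_earlyD (w : List Letter) : D :: w ∈ earlyD := ⟨[], w, by simp⟩

theorem cons_U_mem_earlyD (w : List Letter) : U :: w ∈ earlyD ↔ w ∈ earlyD := by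
  constructor
  · rintro ⟨_ | ⟨a, u⟩, v, h, hu⟩
    · simp at h
    · exact ⟨u, v, by simp_all, by simp_all⟩
  · rintro ⟨u, v, rfl, hu⟩
    exact ⟨U :: u, v, by simp_all⟩

theorem encard_words (r u d : ℕ) :
    (words r u d).encard = ((r + u + d).choose u * (r + d).choose r : ℕ) := by
  induction hN : r + u + d generalizing r u d with
  | zero =>
    obtain ⟨⟨rfl, rfl⟩, rfl⟩ : (r = 0 ∧ u = 0) ∧ d = 0 := by omega
    rw [encard_eq_add_cons]
    simp +contextual [words, Set.ofPred_and]
  | succ N ih =>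
    have hnil : ({w | w = [] ∧ w ∈ words r u d} : Set (List Letter)) = ∅ := by
      ext w
      simp only [words, Set.mem_ofPred_eq, Set.mem_empty_iff_false, iff_false]
      rintro ⟨rfl, h⟩
      simp at h
      omega
    have hR : {w | R :: w ∈ words r u d}.encard =
        ((if r = 0 then 0 else N.choose u * (r - 1 + d).choose (r - 1) : ℕ) : ℕ∞) := by
      rcases r with _ | r
      · simp [words]
      · simpa [words] using ih r u d (by omega)
    have hU : {w | U :: w ∈ words r u d}.encard =
        ((if u = 0 then 0 else N.choose (u - 1) * (r + d).choose r : ℕ) : ℕ∞) := by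
      rcases u with _ | u
      · simp [words]
      · simpa [words] using ih r u d (by omega)
    have hD : {w | D :: w ∈ words r u d}.encard =
        ((if d = 0 then 0 else N.choose u * (r + (d - 1)).choose r : ℕ) : ℕ∞) := by
      rcases d with _ | d
      · simp [words]
      · simpa [words] using ih r u d (by omega)
    rw [encard_eq_add_cons, hnil, hR, hU, hD, Set.encard_empty, zero_add]
    norm_cast
    have pascal : (if r = 0 then 0 else (r - 1 + d).choose (r - 1)) +
        (if d = 0 then 0 else (r + (d - 1)).choose r) =
        if r = 0 ∧ d = 0 then 0 else (r + d).choose r := by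
      rcases r with _ | r <;> rcases d with _ | d <;> simp
      rw [show r + 1 + (d + 1) = (r + d + 1) + 1 by ring, Nat.choose_succ_succ']
      ring_nf
    rcases u with _ | u
    · have : ¬ (r = 0 ∧ d = 0) := by omega
      simpa [this] using pascal
    · rw [Nat.choose_succ_succ]
      by_cases h : r = 0 ∧ d = 0
      · obtain ⟨rfl, rfl⟩ := h
        obtain rfl : u = N := by omega
        simp
      · rw [if_neg h] at pascal
        simp only [Nat.succ_eq_add_one, Nat.add_eq_zero_iff, one_ne_zero, and_false, if_false,
          add_tsub_cancel_right]
        rw [add_mul, ← pascal]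
        split_ifs <;> ring

theorem words_inter_earlyD_zero (r u : ℕ) : words r u 0 ∩ earlyD = ∅ := by
  ext w
  simp only [words, earlyD, Set.mem_inter_iff, Set.mem_ofPred_eq, Set.mem_empty_iff_false,
    iff_false]
  rintro ⟨⟨-, -, h⟩, u, v, rfl, -⟩
  simp at h

theorem encard_words_inter_earlyD (r u d : ℕ) :
    (words r u (d + 1) ∩ earlyD).encard =
      ((r + u + d + 1).choose u * (r + d).choose r : ℕ) := by
  have hnil (u : ℕ) :
      ({w | w = [] ∧ w ∈ words r u (d + 1) ∩ earlyD} : Set (List Letter)) = ∅ := by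
    ext w
    simp +contextual [nil_notMem_earlyD]
  have hD (u : ℕ) : {w | D :: w ∈ words r u (d + 1) ∩ earlyD} = words r u d := by
    ext w
    simp [words, cons_D_mem_earlyD]
  induction u with
  | zero =>
    rw [encard_eq_add_cons, hnil, hD, encard_words]
    simp [words, cons_R_notMem_earlyD]
  | succ u ih =>
    have hU : {w | U :: w ∈ words r (u + 1) (d + 1) ∩ earlyD} =
        words r u (d + 1) ∩ earlyD := by
      ext w
      simp [words, cons_U_mem_earlyD]
    rw [encard_eq_add_cons, hnil, hD, hU, ih, encard_words]
    simp only [Set.mem_inter_iff, cons_R_notMem_earlyD, and_false, Set.ofPred_false,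
      Set.encard_empty, zero_add]
    norm_cast
    rw [show r + (u + 1) + d + 1 = (r + u + d + 1) + 1 by ring, Nat.choose_succ_succ,
      show r + (u + 1) + d = r + u + d + 1 by ring, add_mul]

end Letter

open Letter in
/-- The number of words over {R, U, D} with exactly `k` letters R, `k` letters U and
`n - k` letters D, whose first letter is not D, and in which some occurrence of D
has no R before it, equals `(n + k - 1).choose (k - 1) * (n - 1).choose k`. -/
theorem stmt_0 (n k : ℕ) (hk : 1 ≤ k) (hkn : k ≤ n) :
    Set.ncard {w : List Letter |
        w.count R = k ∧ w.count U = k ∧ w.count D = n - k ∧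
        w.head? ≠ some D ∧ (∃ u v : List Letter, w = u ++ D :: v ∧ R ∉ u)} =
      (n + k - 1).choose (k - 1) * (n - 1).choose k := by
  obtain ⟨k, rfl⟩ : ∃ j, k = j + 1 := ⟨k - 1, by omega⟩
  obtain ⟨d, rfl⟩ := Nat.exists_eq_add_of_le hkn
  have hS : {w : List Letter |
        w.count R = k + 1 ∧ w.count U = k + 1 ∧ w.count D = k + 1 + d - (k + 1) ∧
        w.head? ≠ some D ∧ (∃ u v : List Letter, w = u ++ D :: v ∧ R ∉ u)} =
      List.cons U '' (words (k + 1) k d ∩ earlyD) := by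
    ext w
    change (_ ∧ _ ∧ _ ∧ _ ∧ w ∈ earlyD) ↔ _
    rcases w with _ | ⟨_ | _ | _, w⟩ <;>
      simp [words, nil_notMem_earlyD, cons_R_notMem_earlyD, cons_U_mem_earlyD, and_assoc]
  rw [hS, Set.ncard_image_of_injective _ List.cons_injective]
  rcases d with _ | d
  · simp [words_inter_earlyD_zero]
  · rw [Set.ncard, encard_words_inter_earlyD, ENat.toNat_natCast]
    congr 2
    omega
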